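/- The comultiplication of the crossed product coalgebra C >◀ H is coassociative: (Δ ⊗ id)∘Δ = (id ⊗ Δ)∘Δ on C ⊗ H, where Δ(a ⊗ g) = (a^{(0)} ⊗ g^{(1)}) ⊗ (S^{-1}(g^{(0)} S(g^{(2)})) · a^{(1)} ⊗ g^{(3)}). Explicitly, both iterated coproducts of a ⊗ g equal (a^{(0)} ⊗ g^{(2)}) ⊗ (S^{-1}(g^{(1)}S(g^{(3)})) · a^{(1)} ⊗ g^{(4)}) ⊗ (S^{-1}(g^{(0)}S(g^{(5)})) · a^{(2)} ⊗ g^{(6)}). -/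

import Mathlib

open TensorProduct Coalgebra

noncomputable section

variable {k : Type} [CommRing k]
variable {H : Type} [Ring H] [HopfAlgebra k H]
variable {C : Type} [AddCommGroup C] [Module k C] [Coalgebra k C]

/-- The comultiplication of the crossed product coalgebra `C >◀ H` of a left
`H`-module coalgebra `C`, as a linear map `C ⊗ H →ₗ (C ⊗ H) ⊗ (C ⊗ H)`.
On pure tensors it is given (in Sweedler notation) by
`Δ(a ⊗ g) = (a⁽⁰⁾ ⊗ g⁽¹⁾) ⊗ (S⁻¹(g⁽⁰⁾ S(g⁽²⁾)) · a⁽¹⁾ ⊗ g⁽³⁾)`. -/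
def cpComul (Sinv : H →ₗ[k] H) (act : H →ₗ[k] C →ₗ[k] C) :
    (C ⊗[k] H) →ₗ[k] ((C ⊗[k] H) ⊗[k] (C ⊗[k] H)) :=
  (LinearMap.lTensor (C ⊗[k] H)
      ((LinearMap.rTensor H (TensorProduct.lift act))
        ∘ₗ (TensorProduct.assoc k H C H).symm.toLinearMap
        ∘ₗ (TensorProduct.leftComm k C H H).toLinearMap))
    ∘ₗ (TensorProduct.tensorTensorTensorComm k C C H (H ⊗[k] H)).toLinearMap
    ∘ₗ (TensorProduct.map (Coalgebra.comul (R := k))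
          ((LinearMap.lTensor H
              ((LinearMap.rTensor H Sinv)
                ∘ₗ (LinearMap.rTensor H (LinearMap.mul' k H))
                ∘ₗ (LinearMap.rTensor H
                      (LinearMap.lTensor H (HopfAlgebra.antipode (R := k))))
                ∘ₗ (TensorProduct.assoc k H H H).symm.toLinearMap))
            ∘ₗ (TensorProduct.leftComm k H H (H ⊗[k] H)).toLinearMap
            ∘ₗ (LinearMap.lTensor H (LinearMap.lTensor H (Coalgebra.comul (R := k))))
            ∘ₗ (LinearMap.lTensor H (Coalgebra.comul (R := k)))
            ∘ₗ (Coalgebra.comul (R := k))))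

/-- The iterated comultiplication `g ↦ g⁽⁰⁾ ⊗ (g⁽¹⁾ ⊗ g⁽²⁾)`. -/
def comulTwo : H →ₗ[k] H ⊗[k] (H ⊗[k] H) :=
  LinearMap.lTensor H (Coalgebra.comul (R := k)) ∘ₗ Coalgebra.comul (R := k)

/-- Right multiplication by `u` in the middle factor, `x ⊗ (y ⊗ z) ↦ x ⊗ (y * u ⊗ z)`. -/
def midMulRight : H →ₗ[k] (H ⊗[k] (H ⊗[k] H)) →ₗ[k] (H ⊗[k] (H ⊗[k] H)) :=
  LinearMap.lTensorHom H ∘ₗ LinearMap.rTensorHom H ∘ₗ (LinearMap.mul k H).flip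

@[simp]
lemma midMulRight_tmul (u x y z : H) :
    midMulRight (k := k) u (x ⊗ₜ (y ⊗ₜ z)) = x ⊗ₜ ((y * u) ⊗ₜ z) := rfl

lemma midMulRight_mul (u v : H) (t : H ⊗[k] (H ⊗[k] H)) :
    midMulRight (v * u) t = midMulRight u (midMulRight v t) := by
  suffices h : midMulRight (k := k) (v * u) = midMulRight u ∘ₗ midMulRight v by
    rw [h, LinearMap.comp_apply]
  ext x y z
  simp [mul_assoc]

lemma midMulRight_one (t : H ⊗[k] (H ⊗[k] H)) : midMulRight 1 t = t := by
  suffices h : midMulRight (k := k) (1 : H) = LinearMap.id by rw [h, LinearMap.id_apply]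
  ext x y z
  simp

/-- The map `g ↦ g⁽¹⁾ ⊗ (S⁻¹(g⁽⁰⁾ S(g⁽²⁾)) ⊗ g⁽³⁾)`. -/
def twistedComul (Sinv : H →ₗ[k] H) : H →ₗ[k] H ⊗[k] (H ⊗[k] H) :=
  (LinearMap.lTensor H
      ((LinearMap.rTensor H Sinv)
        ∘ₗ (LinearMap.rTensor H (LinearMap.mul' k H))
        ∘ₗ (LinearMap.rTensor H
              (LinearMap.lTensor H (HopfAlgebra.antipode (R := k))))
        ∘ₗ (TensorProduct.assoc k H H H).symm.toLinearMap))
    ∘ₗ (TensorProduct.leftComm k H H (H ⊗[k] H)).toLinearMap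
    ∘ₗ (LinearMap.lTensor H (LinearMap.lTensor H (Coalgebra.comul (R := k))))
    ∘ₗ (LinearMap.lTensor H (Coalgebra.comul (R := k)))
    ∘ₗ (Coalgebra.comul (R := k))

/-- The map `a ⊗ (x ⊗ y) ↦ x · a ⊗ y`. -/
def actLeft (act : H →ₗ[k] C →ₗ[k] C) : C ⊗[k] (H ⊗[k] H) →ₗ[k] C ⊗[k] H :=
  (LinearMap.rTensor H (TensorProduct.lift act))
    ∘ₗ (TensorProduct.assoc k H C H).symm.toLinearMap
    ∘ₗ (TensorProduct.leftComm k C H H).toLinearMap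

@[simp]
lemma actLeft_tmul {M : Type} [AddCommGroup M] [Module k M]
    (act : H →ₗ[k] M →ₗ[k] M) (a : M) (x y : H) :
    actLeft act (a ⊗ₜ (x ⊗ₜ y)) = act x a ⊗ₜ y := rfl

lemma cpComul_eq (Sinv : H →ₗ[k] H) (act : H →ₗ[k] C →ₗ[k] C) :
    cpComul Sinv act = LinearMap.lTensor (C ⊗[k] H) (actLeft act)
      ∘ₗ (TensorProduct.tensorTensorTensorComm k C C H (H ⊗[k] H)).toLinearMap
      ∘ₗ TensorProduct.map (Coalgebra.comul (R := k)) (twistedComul Sinv) := rfl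

/-- The map `a ⊗ g ↦ g⁽⁰⁾ · a ⊗ g⁽¹⁾`. -/
def actComul (act : H →ₗ[k] C →ₗ[k] C) : C ⊗[k] H →ₗ[k] C ⊗[k] H :=
  actLeft act ∘ₗ LinearMap.lTensor C (Coalgebra.comul (R := k))

/-- The map `(a ⊗ b) ⊗ (x ⊗ (y ⊗ (z ⊗ w))) ↦ (x · a ⊗ y) ⊗ (z · b ⊗ w)`. -/
def actLeftPair (act : H →ₗ[k] C →ₗ[k] C) :
    (C ⊗[k] C) ⊗[k] (H ⊗[k] (H ⊗[k] (H ⊗[k] H))) →ₗ[k] (C ⊗[k] H) ⊗[k] (C ⊗[k] H) :=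
  TensorProduct.map (actLeft act) (actLeft act)
    ∘ₗ (TensorProduct.tensorTensorTensorComm k C C (H ⊗[k] H) (H ⊗[k] H)).toLinearMap
    ∘ₗ LinearMap.lTensor (C ⊗[k] C) (TensorProduct.assoc k H H (H ⊗[k] H)).symm.toLinearMap

@[simp]
lemma actLeftPair_tmul {M : Type} [AddCommGroup M] [Module k M]
    (act : H →ₗ[k] M →ₗ[k] M) (a b : M) (x y z w : H) :
    actLeftPair act ((a ⊗ₜ b) ⊗ₜ (x ⊗ₜ (y ⊗ₜ (z ⊗ₜ w)))) =
      (act x a ⊗ₜ y) ⊗ₜ (act z b ⊗ₜ w) := rfl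

section InverseAntipode

variable {Sinv : H →ₗ[k] H}

lemma inverseAntipode_mul
    (hSinv₁ : ∀ h : H, Sinv (HopfAlgebra.antipode (R := k) h) = h)
    (hSinv₂ : ∀ h : H, HopfAlgebra.antipode (R := k) (Sinv h) = h) (x y : H) :
    Sinv (x * y) = Sinv y * Sinv x := by
  rw [← hSinv₁ (Sinv y * Sinv x), HopfAlgebra.antipode_mul_antidistrib, hSinv₂, hSinv₂]

/-- `S⁻¹(g⁽¹⁾) g⁽⁰⁾ = ε(g)`. -/
lemma mul_inverseAntipode_comm_comul
    (hSinv₁ : ∀ h : H, Sinv (HopfAlgebra.antipode (R := k) h) = h)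
    (hSinv₂ : ∀ h : H, HopfAlgebra.antipode (R := k) (Sinv h) = h) (g : H) :
    LinearMap.mul' k H (LinearMap.rTensor H Sinv
      (TensorProduct.comm k H H (Coalgebra.comul g))) = algebraMap k H (Coalgebra.counit g) := by
  have h : LinearMap.mul' k H ∘ₗ LinearMap.rTensor H Sinv ∘ₗ
      (TensorProduct.comm k H H).toLinearMap =
      Sinv ∘ₗ LinearMap.mul' k H ∘ₗ LinearMap.rTensor H (HopfAlgebra.antipode k) := by
    ext x y
    simp [inverseAntipode_mul hSinv₁ hSinv₂, hSinv₁]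
  have h_one : Sinv 1 = 1 := by simpa using hSinv₁ 1
  have := LinearMap.congr_fun h (Coalgebra.comul g)
  simp only [LinearMap.comp_apply, LinearEquiv.coe_coe,
    HopfAlgebra.mul_antipode_rTensor_comul_apply] at this
  rw [this, Algebra.algebraMap_eq_smul_one, map_smul, h_one]

/-- `g⁽¹⁾ S⁻¹(g⁽⁰⁾) = ε(g)`. -/
lemma mul_comm_inverseAntipode_comul
    (hSinv₁ : ∀ h : H, Sinv (HopfAlgebra.antipode (R := k) h) = h)
    (hSinv₂ : ∀ h : H, HopfAlgebra.antipode (R := k) (Sinv h) = h) (g : H) :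
    LinearMap.mul' k H (LinearMap.lTensor H Sinv
      (TensorProduct.comm k H H (Coalgebra.comul g))) = algebraMap k H (Coalgebra.counit g) := by
  have h : LinearMap.mul' k H ∘ₗ LinearMap.lTensor H Sinv ∘ₗ
      (TensorProduct.comm k H H).toLinearMap =
      Sinv ∘ₗ LinearMap.mul' k H ∘ₗ LinearMap.lTensor H (HopfAlgebra.antipode k) := by
    ext x y
    simp [inverseAntipode_mul hSinv₁ hSinv₂, hSinv₁]
  have h_one : Sinv 1 = 1 := by simpa using hSinv₁ 1
  have := LinearMap.congr_fun h (Coalgebra.comul g)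
  simp only [LinearMap.comp_apply, LinearEquiv.coe_coe,
    HopfAlgebra.mul_antipode_lTensor_comul_apply] at this
  rw [this, Algebra.algebraMap_eq_smul_one, map_smul, h_one]

/-- Since `S⁻¹(x S(z)) = z S⁻¹(x)`, the twisted comultiplication sends `g` to
`g⁽¹⁾ ⊗ (g⁽²⁾ S⁻¹(g⁽⁰⁾) ⊗ g⁽³⁾)`. -/
lemma twistedComul_eq
    (hSinv₁ : ∀ h : H, Sinv (HopfAlgebra.antipode (R := k) h) = h)
    (hSinv₂ : ∀ h : H, HopfAlgebra.antipode (R := k) (Sinv h) = h) :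
    twistedComul Sinv =
      TensorProduct.lift (midMulRight ∘ₗ Sinv)
        ∘ₗ LinearMap.lTensor H comulTwo ∘ₗ Coalgebra.comul (R := k) := by
  have h : (LinearMap.lTensor H
      ((LinearMap.rTensor H Sinv)
        ∘ₗ (LinearMap.rTensor H (LinearMap.mul' k H))
        ∘ₗ (LinearMap.rTensor H
              (LinearMap.lTensor H (HopfAlgebra.antipode (R := k))))
        ∘ₗ (TensorProduct.assoc k H H H).symm.toLinearMap))
      ∘ₗ (TensorProduct.leftComm k H H (H ⊗[k] H)).toLinearMap =
      TensorProduct.lift (midMulRight ∘ₗ Sinv) := by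
    ext x y z w
    simp [inverseAntipode_mul hSinv₁ hSinv₂, hSinv₁]
  rw [twistedComul, comulTwo, ← h,
    LinearMap.lTensor_comp H (LinearMap.lTensor H (Coalgebra.comul (R := k)))]
  rfl

/-- `midMulRight` by `g⁽⁰⁾` undoes the twist of `g⁽¹⁾`. -/
lemma lift_midMulRight_twistedComul_comul
    (hSinv₁ : ∀ h : H, Sinv (HopfAlgebra.antipode (R := k) h) = h)
    (hSinv₂ : ∀ h : H, HopfAlgebra.antipode (R := k) (Sinv h) = h) :
    TensorProduct.lift midMulRight ∘ₗ LinearMap.lTensor H (twistedComul Sinv)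
      ∘ₗ Coalgebra.comul (R := k) = comulTwo := by
  let F : H ⊗[k] (H ⊗[k] H) →ₗ[k] H ⊗[k] (H ⊗[k] H) :=
    TensorProduct.lift midMulRight ∘ₗ LinearMap.lTensor H
      (TensorProduct.lift (midMulRight ∘ₗ Sinv) ∘ₗ LinearMap.lTensor H comulTwo)
  have h_assoc : F ∘ₗ (TensorProduct.assoc k H H H).toLinearMap =
      TensorProduct.lift (midMulRight.compl₂ comulTwo) ∘ₗ LinearMap.rTensor H
        (LinearMap.mul' k H ∘ₗ LinearMap.rTensor H Sinv ∘ₗ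
          (TensorProduct.comm k H H).toLinearMap) := by
    ext x y z
    simp [F, midMulRight_mul]
  have h_counit : TensorProduct.lift (midMulRight.compl₂ comulTwo) ∘ₗ LinearMap.rTensor H
        (LinearMap.mul' k H ∘ₗ LinearMap.rTensor H Sinv ∘ₗ
          (TensorProduct.comm k H H).toLinearMap) ∘ₗ
        LinearMap.rTensor H (Coalgebra.comul (R := k)) =
      comulTwo ∘ₗ (TensorProduct.lid k H).toLinearMap ∘ₗ
        LinearMap.rTensor H (Coalgebra.counit (R := k)) := by
    ext x y
    simp [mul_inverseAntipode_comm_comul hSinv₁ hSinv₂, Algebra.algebraMap_eq_smul_one,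
      midMulRight_one]
  ext g
  have h := LinearMap.congr_fun h_counit (Coalgebra.comul g)
  rw [← LinearMap.comp_assoc, ← h_assoc] at h
  simp only [LinearMap.comp_apply, LinearEquiv.coe_coe, Coalgebra.coassoc_apply,
    Coalgebra.rTensor_counit_comul, TensorProduct.lid_tmul, one_smul] at h
  rw [twistedComul_eq hSinv₁ hSinv₂, ← h]
  simp only [F, LinearMap.lTensor_comp, LinearMap.comp_apply]

/-- The map `a ⊗ g ↦ g⁽⁰⁾ · a ⊗ g⁽¹⁾` has the right inverse `a ⊗ g ↦ S⁻¹(g⁽⁰⁾) · a ⊗ g⁽¹⁾`. -/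
lemma actComul_comp_actLeft_inverseAntipode
    (hSinv₁ : ∀ h : H, Sinv (HopfAlgebra.antipode (R := k) h) = h)
    (hSinv₂ : ∀ h : H, HopfAlgebra.antipode (R := k) (Sinv h) = h)
    {M : Type} [AddCommGroup M] [Module k M]
    {act : H →ₗ[k] M →ₗ[k] M} (hact_one : act 1 = LinearMap.id)
    (hact_mul : ∀ g h : H, act (g * h) = act g ∘ₗ act h) :
    actComul act ∘ₗ actLeft act ∘ₗ LinearMap.lTensor M (LinearMap.rTensor H Sinv)
      ∘ₗ LinearMap.lTensor M (Coalgebra.comul (R := k)) = LinearMap.id := by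
  have h_assoc : actLeft act ∘ₗ LinearMap.lTensor M (LinearMap.rTensor H
        (LinearMap.mul' k H ∘ₗ LinearMap.lTensor H Sinv ∘ₗ
          (TensorProduct.comm k H H).toLinearMap) ∘ₗ
          (TensorProduct.assoc k H H H).symm.toLinearMap ∘ₗ
          LinearMap.lTensor H (Coalgebra.comul (R := k))) =
      actComul act ∘ₗ actLeft act ∘ₗ LinearMap.lTensor M (LinearMap.rTensor H Sinv) := by
    ext a x y
    simp only [actComul, TensorProduct.AlgebraTensorModule.curry_apply, LinearMap.comp_apply,
      TensorProduct.curry_apply, LinearMap.restrictScalars_self, LinearMap.lTensor_tmul,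
      LinearMap.rTensor_tmul, LinearEquiv.coe_coe, actLeft_tmul]
    induction Coalgebra.comul (R := k) y with
    | zero => simp
    | add u v hu hv => simp only [TensorProduct.tmul_add, map_add, hu, hv]
    | tmul u v => simp [hact_mul]
  have h_counit : LinearMap.rTensor H
        (LinearMap.mul' k H ∘ₗ LinearMap.lTensor H Sinv ∘ₗ
          (TensorProduct.comm k H H).toLinearMap) ∘ₗ
        LinearMap.rTensor H (Coalgebra.comul (R := k)) =
      LinearMap.rTensor H (Algebra.linearMap k H) ∘ₗ
        LinearMap.rTensor H (Coalgebra.counit (R := k)) := by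
    ext x y
    simp [mul_comm_inverseAntipode_comul hSinv₁ hSinv₂]
  ext a g
  have h := LinearMap.congr_fun h_counit (Coalgebra.comul g)
  have h' := LinearMap.congr_fun h_assoc (a ⊗ₜ Coalgebra.comul g)
  simp only [LinearMap.comp_apply, LinearMap.lTensor_tmul, LinearEquiv.coe_coe,
    Coalgebra.coassoc_symm_apply, Coalgebra.rTensor_counit_comul] at h h'
  rw [h] at h'
  simpa [hact_one] using h'.symm

end InverseAntipode

/-- On `x · a ⊗ y`, the crossed comultiplication is
`(x⁽⁰⁾ · a⁽⁰⁾ ⊗ y⁽¹⁾) ⊗ (S⁻¹(y⁽⁰⁾ S(y⁽²⁾)) x⁽¹⁾ · a⁽¹⁾ ⊗ y⁽³⁾)`. -/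
lemma cpComul_comp_actLeft (Sinv : H →ₗ[k] H) {act : H →ₗ[k] C →ₗ[k] C}
    (hact_mul : ∀ g h : H, act (g * h) = act g ∘ₗ act h)
    (hact_comul : (Coalgebra.comul (R := k)) ∘ₗ TensorProduct.lift act
      = (TensorProduct.map (TensorProduct.lift act) (TensorProduct.lift act))
          ∘ₗ (TensorProduct.tensorTensorTensorComm k H H C C).toLinearMap
          ∘ₗ (TensorProduct.map (Coalgebra.comul (R := k)) (Coalgebra.comul (R := k)))) :
    cpComul Sinv act ∘ₗ actLeft act =
      actLeftPair act ∘ₗ TensorProduct.map (Coalgebra.comul (R := k))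
        (LinearMap.lTensor H
            (TensorProduct.lift midMulRight ∘ₗ LinearMap.lTensor H (twistedComul Sinv))
          ∘ₗ (TensorProduct.assoc k H H H).toLinearMap
          ∘ₗ LinearMap.rTensor H (Coalgebra.comul (R := k))) := by
  ext a x y
  have h := LinearMap.congr_fun hact_comul (x ⊗ₜ a)
  simp only [LinearMap.comp_apply, TensorProduct.lift.tmul, TensorProduct.map_tmul,
    LinearEquiv.coe_coe] at h
  simp only [TensorProduct.AlgebraTensorModule.curry_apply, LinearMap.comp_apply,
    TensorProduct.curry_apply, LinearMap.restrictScalars_self, cpComul_eq, actLeft_tmul,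
    TensorProduct.map_tmul, LinearMap.rTensor_tmul, LinearEquiv.coe_coe, h]
  induction Coalgebra.comul (R := k) x with
  | zero => simp
  | add u v hu hv =>
    simp only [TensorProduct.tmul_add, TensorProduct.add_tmul, map_add, hu, hv]
  | tmul x₀ x₁ =>
    induction Coalgebra.comul (R := k) a with
    | zero => simp
    | add u v hu hv =>
      simp only [TensorProduct.tmul_add, TensorProduct.add_tmul, map_add, hu, hv]
    | tmul a₀ a₁ =>
      simp only [TensorProduct.tensorTensorTensorComm_tmul, TensorProduct.map_tmul,
        TensorProduct.lift.tmul, TensorProduct.assoc_tmul, LinearMap.lTensor_tmul,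
        LinearMap.comp_apply]
      have key : ∀ t : H ⊗[k] (H ⊗[k] H),
          LinearMap.lTensor (C ⊗[k] H) (actLeft act)
            (TensorProduct.tensorTensorTensorComm k C C H (H ⊗[k] H)
              ((act x₀ a₀ ⊗ₜ act x₁ a₁) ⊗ₜ t)) =
          actLeftPair act ((a₀ ⊗ₜ a₁) ⊗ₜ (x₀ ⊗ₜ midMulRight x₁ t)) := by
        intro t
        induction t with
        | zero => simp
        | add u v hu hv => simp only [TensorProduct.tmul_add, map_add, hu, hv]
        | tmul y₀ s =>
          induction s with
          | zero => simp
          | add u v hu hv => simp only [TensorProduct.tmul_add, map_add, hu, hv]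
          | tmul y₁ y₂ => simp [hact_mul]
      exact key _

/-- The map `a ⊗ g ↦ g⁽⁰⁾ · a ⊗ g⁽¹⁾` intertwines the comultiplication of the tensor product
coalgebra `C ⊗ H` with that of the crossed product coalgebra. -/
lemma cpComul_comp_actComul {Sinv : H →ₗ[k] H}
    (hSinv₁ : ∀ h : H, Sinv (HopfAlgebra.antipode (R := k) h) = h)
    (hSinv₂ : ∀ h : H, HopfAlgebra.antipode (R := k) (Sinv h) = h)
    {act : H →ₗ[k] C →ₗ[k] C}
    (hact_mul : ∀ g h : H, act (g * h) = act g ∘ₗ act h)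
    (hact_comul : (Coalgebra.comul (R := k)) ∘ₗ TensorProduct.lift act
      = (TensorProduct.map (TensorProduct.lift act) (TensorProduct.lift act))
          ∘ₗ (TensorProduct.tensorTensorTensorComm k H H C C).toLinearMap
          ∘ₗ (TensorProduct.map (Coalgebra.comul (R := k)) (Coalgebra.comul (R := k)))) :
    cpComul Sinv act ∘ₗ actComul act =
      TensorProduct.map (actComul act) (actComul act) ∘ₗ Coalgebra.comul (R := k) := by
  have h_pair : TensorProduct.map (actComul act) (actComul act) ∘ₗ
      (TensorProduct.tensorTensorTensorComm k C C H H).toLinearMap =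
      actLeftPair act ∘ₗ LinearMap.lTensor (C ⊗[k] C)
        ((TensorProduct.assoc k H H (H ⊗[k] H)).toLinearMap ∘ₗ
          TensorProduct.map (Coalgebra.comul (R := k)) (Coalgebra.comul (R := k))) := by
    ext a b x y
    simp [actComul, actLeftPair]
  have h_comul : TensorProduct.assoc k H H (H ⊗[k] H) ∘ₗ
        TensorProduct.map (Coalgebra.comul (R := k)) (Coalgebra.comul (R := k)) =
      LinearMap.lTensor H (LinearMap.lTensor H (Coalgebra.comul (R := k)))
        ∘ₗ (TensorProduct.assoc k H H H).toLinearMap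
        ∘ₗ LinearMap.rTensor H (Coalgebra.comul (R := k)) := by
    ext x y
    simp only [TensorProduct.AlgebraTensorModule.curry_apply, LinearMap.comp_apply,
      TensorProduct.curry_apply, LinearMap.restrictScalars_self, TensorProduct.map_tmul,
      LinearMap.rTensor_tmul, LinearEquiv.coe_coe]
    induction Coalgebra.comul (R := k) x with
    | zero => simp
    | add u v hu hv => simp only [TensorProduct.add_tmul, map_add, hu, hv]
    | tmul u v => simp
  ext a g
  have h_act := LinearMap.congr_fun (cpComul_comp_actLeft Sinv hact_mul hact_comul)
    (a ⊗ₜ Coalgebra.comul g)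
  have h_pair_apply := LinearMap.congr_fun h_pair
    (Coalgebra.comul (R := k) a ⊗ₜ Coalgebra.comul (R := k) g)
  have h_comul_apply := LinearMap.congr_fun h_comul (Coalgebra.comul (R := k) g)
  simp only [LinearMap.comp_apply, LinearEquiv.coe_coe, TensorProduct.map_tmul,
    LinearMap.lTensor_tmul, Coalgebra.coassoc_apply] at h_act h_pair_apply h_comul_apply
  rw [h_comul_apply, ← LinearMap.comp_apply (LinearMap.lTensor H _), ← LinearMap.lTensor_comp,
    ← comulTwo, ← lift_midMulRight_twistedComul_comul hSinv₁ hSinv₂] at h_pair_apply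
  simp only [TensorProduct.AlgebraTensorModule.curry_apply, LinearMap.comp_apply,
    TensorProduct.curry_apply, LinearMap.restrictScalars_self, actComul,
    LinearMap.lTensor_tmul, TensorProduct.comul_tmul,
    TensorProduct.AlgebraTensorModule.tensorTensorTensorComm_eq] at h_pair_apply ⊢
  rw [h_act, h_pair_apply]
  simp only [LinearMap.lTensor_comp, LinearMap.comp_apply]

/-- The comultiplication of the crossed product coalgebra `C >◀ H`,
`Δ(a ⊗ g) = (a⁽⁰⁾ ⊗ g⁽¹⁾) ⊗ (S⁻¹(g⁽⁰⁾ S(g⁽²⁾)) · a⁽¹⁾ ⊗ g⁽³⁾)`, is coassociative: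
`(Δ ⊗ id) ∘ Δ = (id ⊗ Δ) ∘ Δ` (up to the associator of the tensor product). -/
theorem cpComul_coassoc
    (Sinv : H →ₗ[k] H)
    (hSinv₁ : ∀ h : H, Sinv (HopfAlgebra.antipode (R := k) h) = h)
    (hSinv₂ : ∀ h : H, HopfAlgebra.antipode (R := k) (Sinv h) = h)
    (act : H →ₗ[k] C →ₗ[k] C)
    (hact_one : act 1 = LinearMap.id)
    (hact_mul : ∀ g h : H, act (g * h) = act g ∘ₗ act h)
    (hact_comul : (Coalgebra.comul (R := k)) ∘ₗ TensorProduct.lift act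
      = (TensorProduct.map (TensorProduct.lift act) (TensorProduct.lift act))
          ∘ₗ (TensorProduct.tensorTensorTensorComm k H H C C).toLinearMap
          ∘ₗ (TensorProduct.map (Coalgebra.comul (R := k)) (Coalgebra.comul (R := k))))
    (hact_counit : (Coalgebra.counit (R := k)) ∘ₗ TensorProduct.lift act
      = (TensorProduct.lid k k).toLinearMap
          ∘ₗ TensorProduct.map (Coalgebra.counit (R := k)) (Coalgebra.counit (R := k))) :
    (LinearMap.rTensor (C ⊗[k] H) (cpComul Sinv act)) ∘ₗ (cpComul Sinv act)
      = (TensorProduct.assoc k (C ⊗[k] H) (C ⊗[k] H) (C ⊗[k] H)).symm.toLinearMap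
          ∘ₗ (LinearMap.lTensor (C ⊗[k] H) (cpComul Sinv act))
          ∘ₗ (cpComul Sinv act) := by
  have h_inter := cpComul_comp_actComul hSinv₁ hSinv₂ hact_mul hact_comul
  have h_map_left : LinearMap.rTensor (C ⊗[k] H) (cpComul Sinv act) ∘ₗ
      TensorProduct.map (actComul act) (actComul act) =
      TensorProduct.map (TensorProduct.map (actComul act) (actComul act)) (actComul act) ∘ₗ
        LinearMap.rTensor (C ⊗[k] H) (Coalgebra.comul (R := k)) := by
    rw [LinearMap.rTensor_comp_map, LinearMap.map_comp_rTensor, h_inter]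
  have h_map_right : LinearMap.lTensor (C ⊗[k] H) (cpComul Sinv act) ∘ₗ
      TensorProduct.map (actComul act) (actComul act) =
      TensorProduct.map (actComul act) (TensorProduct.map (actComul act) (actComul act)) ∘ₗ
        LinearMap.lTensor (C ⊗[k] H) (Coalgebra.comul (R := k)) := by
    rw [LinearMap.lTensor_comp_map, LinearMap.map_comp_lTensor, h_inter]
  have h_surj := actComul_comp_actLeft_inverseAntipode hSinv₁ hSinv₂ hact_one hact_mul
  refine LinearMap.ext fun t => ?_
  obtain ⟨s, rfl⟩ : ∃ s, actComul act s = t := ⟨_, LinearMap.congr_fun h_surj t⟩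
  have h_inter_apply := LinearMap.congr_fun h_inter s
  have h_left := LinearMap.congr_fun h_map_left (Coalgebra.comul s)
  have h_right := LinearMap.congr_fun h_map_right (Coalgebra.comul s)
  simp only [LinearMap.comp_apply, LinearEquiv.coe_coe] at h_inter_apply h_left h_right ⊢
  rw [h_inter_apply, h_left, h_right, ← Coalgebra.coassoc_apply, LinearEquiv.eq_symm_apply,
    TensorProduct.map_map_assoc]

end
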